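/- arXiv:math/0201027 — 3 statements merged into one kernel-verified Lean document; each statement's English description precedes it below -/
import Mathlib

section
/- (8-fold periodicity of Clifford algebras.) For every integer k ≥ 0, the Clifford algebra C_{k+8} is isomorphic as a real algebra to the tensor product (over ℝ) of C_k with the algebra of 16 × 16 real matrices; equivalently, C_{k+8} ≅ Matrix₁₆ₓ₁₆(C_k). -/
/-- The Clifford algebra `C_k` of the negative definite quadratic form
`Q(x) = -(x₁² + ⋯ + x_k²)` on `ℝ^k`. -/
abbrev CliffordC (k : ℕ) :=
  CliffordAlgebra (QuadraticMap.weightedSumSquares ℝ (fun _ : Fin k => (-1 : ℝ)))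

section SumSquares

theorem algebraMap_neg_two {B : Type*} [Ring B] [Algebra ℝ B] :
    algebraMap ℝ B (-2) = -2 := by
  simp [map_ofNat]

theorem mul_self_sum_smul_of_anticommute {n : ℕ} {B : Type*} [Ring B] [Algebra ℝ B]
    (F : Fin n → B) (hF : ∀ i j, F i * F j + F j * F i = if i = j then -2 else 0)
    (x : Fin n → ℝ) :
    (∑ i, x i • F i) * (∑ i, x i • F i) = algebraMap ℝ B (∑ i, -(x i * x i)) := by
  have hexp : (∑ i, x i • F i) * (∑ i, x i • F i)
      = ∑ i, ∑ j, (x i * x j) • (F i * F j) := by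
    simp only [Finset.sum_mul_sum, smul_mul_smul_comm]
  have hswap : ∑ i, ∑ j, (x i * x j) • (F i * F j)
      = ∑ i, ∑ j, (x i * x j) • (F j * F i) := by
    rw [Finset.sum_comm]
    exact Finset.sum_congr rfl fun i _ => Finset.sum_congr rfl fun j _ => by rw [mul_comm (x j)]
  have htwo : (2 : ℝ) • ((∑ i, x i • F i) * (∑ i, x i • F i))
      = (2 : ℝ) • algebraMap ℝ B (∑ i, -(x i * x i)) := by
    rw [two_smul, hexp]
    nth_rewrite 2 [hswap]
    simp only [← Finset.sum_add_distrib, ← smul_add, hF, smul_ite, smul_zero,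
      Finset.sum_ite_eq, Finset.mem_univ, if_true]
    rw [map_sum, Finset.smul_sum]
    refine Finset.sum_congr rfl fun i _ => ?_
    rw [Algebra.algebraMap_eq_smul_one, neg_smul, smul_neg, smul_neg, smul_comm, two_smul]
    rw [show (2 : B) = 1 + 1 by norm_num, smul_add]
  exact smul_right_injective B (two_ne_zero' ℝ) htwo

end SumSquares

namespace CliffordC

/-- The `i`-th standard generator of `C_k`. -/
noncomputable def gen {k : ℕ} (i : Fin k) : CliffordC k :=
  CliffordAlgebra.ι _ (Pi.single i 1)

theorem gen_mul_add_swap {k : ℕ} (i j : Fin k) :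
    gen i * gen j + gen j * gen i = if i = j then -2 else 0 := by
  rw [gen, gen, CliffordAlgebra.ι_mul_ι_add_swap]
  have h : ∀ l : Fin k, (Pi.single i (1 : ℝ) : Fin k → ℝ) l * (Pi.single j (1 : ℝ) : Fin k → ℝ) l
      = if l = i then (if i = j then 1 else 0) else 0 := by
    intro l
    simp only [Pi.single_apply]
    grind
  have h2 : QuadraticMap.polar (QuadraticMap.weightedSumSquares ℝ (fun _ : Fin k => (-1 : ℝ)))
      (Pi.single i 1) (Pi.single j 1) = if i = j then -2 else 0 := by
    simp only [QuadraticMap.polar, QuadraticMap.weightedSumSquares_apply,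
      ← Finset.sum_sub_distrib, Pi.add_apply]
    rw [Finset.sum_congr rfl (g := fun l => -2 * if l = i then (if i = j then 1 else 0) else 0)]
    · simp
    · intro l _
      rw [← h l]
      simp only [smul_eq_mul]
      ring
  rw [h2]
  split_ifs
  · exact algebraMap_neg_two
  · exact map_zero _

theorem ι_eq_sum_gen {k : ℕ} (x : Fin k → ℝ) :
    (CliffordAlgebra.ι _ x : CliffordC k) = ∑ i, x i • gen i := by
  conv_lhs => rw [pi_eq_sum_univ' x]
  simp only [map_sum, map_smul, gen]

theorem exists_algHom {k : ℕ} {B : Type*} [Ring B] [Algebra ℝ B] (F : Fin k → B)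
    (hF : ∀ i j, F i * F j + F j * F i = if i = j then -2 else 0) :
    ∃ φ : CliffordC k →ₐ[ℝ] B, ∀ i, φ (gen i) = F i := by
  refine ⟨CliffordAlgebra.lift _ ⟨Fintype.linearCombination ℝ F, fun x => ?_⟩, fun i => ?_⟩
  · rw [Fintype.linearCombination_apply, mul_self_sum_smul_of_anticommute F hF]
    simp [QuadraticMap.weightedSumSquares_apply]
  · rw [gen, CliffordAlgebra.lift_ι_apply, Fintype.linearCombination_apply_single, one_smul]

theorem mem_of_gen_mem {k : ℕ} (S : Subalgebra ℝ (CliffordC k)) (hS : ∀ i, gen i ∈ S)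
    (a : CliffordC k) : a ∈ S := by
  induction a using CliffordAlgebra.induction with
  | algebraMap r => exact S.algebraMap_mem r
  | ι x =>
    rw [ι_eq_sum_gen]
    exact S.sum_mem fun i _ => S.smul_mem (hS i) _
  | mul a b ha hb => exact S.mul_mem ha hb
  | add a b ha hb => exact S.add_mem ha hb

/-- The linear basis of `C_k` indexed by subsets of the standard generators. -/
noncomputable def basis (k : ℕ) : Module.Basis (Finset (Fin k)) ℝ (CliffordC k) :=
  (Pi.basisFun ℝ (Fin k)).ExteriorAlgebra.map (CliffordAlgebra.equivExterior _).symm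

instance (k : ℕ) : FiniteDimensional ℝ (CliffordC k) :=
  (basis k).finiteDimensional_of_finite

theorem finrank_eq (k : ℕ) : Module.finrank ℝ (CliffordC k) = 2 ^ k := by
  simp [Module.finrank_eq_card_basis (basis k)]

end CliffordC

section Pauli

/-- The nontrivial additive character `ZMod 2 → {1, -1}`, with values in `ℝ`. -/
def zmodTwoSign (c : ZMod 2) : ℝ := if c = 0 then 1 else -1

@[simp]
theorem zmodTwoSign_zero : zmodTwoSign 0 = 1 := if_pos rfl

@[simp]
theorem zmodTwoSign_one : zmodTwoSign 1 = -1 := if_neg one_ne_zero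

theorem zmodTwoSign_add (c d : ZMod 2) :
    zmodTwoSign (c + d) = zmodTwoSign c * zmodTwoSign d := by
  have h : ∀ e : ZMod 2, e = 0 ∨ e = 1 := by decide
  rcases h c with rfl | rfl <;> rcases h d with rfl | rfl <;>
    simp [CharTwo.add_self_eq_zero]

theorem zmodTwoSign_mul_self (c : ZMod 2) : zmodTwoSign c * zmodTwoSign c = 1 := by
  rw [zmodTwoSign]
  split_ifs <;> norm_num

variable {ι : Type*} [Fintype ι]

variable {A : Type*} [Ring A] [Algebra ℝ A]

/-- The real Pauli matrix (shift by `v.1` after the diagonal of signs given by `v.2`), scaled by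
`a`. -/
def pauli (v : (ι → ZMod 2) × (ι → ZMod 2)) : A →ₗ[ℝ] Matrix (ι → ZMod 2) (ι → ZMod 2) A where
  toFun a := Matrix.of fun i j => if i = j + v.1 then zmodTwoSign (v.2 ⬝ᵥ j) • a else 0
  map_add' a b := by
    ext i j
    simp only [Matrix.of_apply, Matrix.add_apply, smul_add]
    split_ifs <;> simp
  map_smul' r a := by
    ext i j
    simp only [Matrix.of_apply, Matrix.smul_apply, RingHom.id_apply, smul_ite, smul_zero]
    rw [smul_comm]

theorem pauli_apply (v : (ι → ZMod 2) × (ι → ZMod 2)) (a : A) (i j : ι → ZMod 2) :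
    pauli v a i j = if i = j + v.1 then zmodTwoSign (v.2 ⬝ᵥ j) • a else 0 := rfl

variable [DecidableEq ι]

theorem sum_zmodTwoSign_dotProduct (x : ι → ZMod 2) :
    ∑ z : ι → ZMod 2, zmodTwoSign (z ⬝ᵥ x) = if x = 0 then 2 ^ Fintype.card ι else 0 := by
  split_ifs with h
  · simp [h]
  · obtain ⟨i, hi⟩ := Function.ne_iff.mp h
    have hi : x i = 1 := Fin.eq_one_of_ne_zero _ hi
    have := Equiv.sum_comp (Equiv.addRight (Pi.single i (1 : ZMod 2)))
      fun z : ι → ZMod 2 => zmodTwoSign (z ⬝ᵥ x)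
    simp only [Equiv.coe_addRight, add_dotProduct, single_dotProduct, hi, zmodTwoSign_add,
      mul_one, zmodTwoSign_one, mul_neg, Finset.sum_neg_distrib] at this
    linarith

theorem pauli_mul_pauli (v w : (ι → ZMod 2) × (ι → ZMod 2)) (a b : A) :
    pauli v a * pauli w b = zmodTwoSign (v.2 ⬝ᵥ w.1) • pauli (v + w) (a * b) := by
  ext i j
  simp only [Matrix.mul_apply, Matrix.smul_apply, pauli_apply, mul_ite, mul_zero,
    Finset.sum_ite_eq', Finset.mem_univ, if_true, Prod.fst_add, Prod.snd_add, smul_ite,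
    smul_zero, dotProduct_add, add_dotProduct, zmodTwoSign_add, ite_mul, zero_mul,
    smul_mul_smul_comm, smul_smul, add_assoc, add_comm w.1]
  congr 2
  ring

theorem pauli_zero_algebraMap (r : ℝ) :
    pauli (0 : (ι → ZMod 2) × (ι → ZMod 2)) (algebraMap ℝ A r) = algebraMap ℝ _ r := by
  ext i j
  simp [pauli_apply, Matrix.algebraMap_matrix_apply]

theorem pauli_zero_one : pauli (0 : (ι → ZMod 2) × (ι → ZMod 2)) (1 : A) = 1 := by
  simpa using pauli_zero_algebraMap (ι := ι) (A := A) 1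

theorem single_eq_smul_sum_pauli (i j : ι → ZMod 2) (a : A) :
    Matrix.single i j a = ((2 : ℝ) ^ Fintype.card ι)⁻¹ •
      ∑ z : ι → ZMod 2, zmodTwoSign (z ⬝ᵥ j) • pauli (i - j, z) a := by
  ext k l
  simp only [Matrix.smul_apply, Matrix.sum_apply, pauli_apply, smul_ite, smul_zero, smul_smul,
    ← zmodTwoSign_add, ← dotProduct_add]
  have hjl : j + l = 0 ↔ j = l := by
    rw [add_eq_zero_iff_eq_neg, show -l = l from funext fun i => ZMod.neg_eq_self_mod_two _]
  by_cases hk : k = l + (i - j)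
  · simp only [hk, if_true, ← Finset.sum_smul, sum_zmodTwoSign_dotProduct, hjl, Matrix.single_apply]
    split_ifs with h1 h2 h2
    · simp
    · exact absurd h1.2 h2
    · exact absurd ⟨by simp [h2], h2⟩ h1
    · simp
  · have : ¬ (i = k ∧ j = l) := by
      rintro ⟨rfl, rfl⟩
      simp at hk
    simp [hk, this]

theorem ZMod.smul_eq_zero_or_self_of_two {M : Type*} [AddCommGroup M] [Module (ZMod 2) M]
    (c : ZMod 2) (x : M) : c • x = 0 ∨ c • x = x := by
  fin_cases c
  · exact Or.inl (zero_smul _ x)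
  · exact Or.inr (one_smul _ x)

/-- The labels of the Pauli matrices lying in a given subalgebra. -/
def pauliLabels (S : Subalgebra ℝ (Matrix (ι → ZMod 2) (ι → ZMod 2) A)) :
    Submodule (ZMod 2) ((ι → ZMod 2) × (ι → ZMod 2)) where
  carrier := {v | pauli v (1 : A) ∈ S}
  zero_mem' := by
    rw [Set.mem_ofPred_eq, pauli_zero_one]
    exact S.one_mem
  add_mem' {v w} hv hw := by
    have h := S.smul_mem (S.mul_mem hv hw) (zmodTwoSign (v.2 ⬝ᵥ w.1))
    rwa [pauli_mul_pauli, smul_smul, zmodTwoSign_mul_self, one_smul, one_mul] at h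
  smul_mem' c v hv := by
    rcases ZMod.smul_eq_zero_or_self_of_two c v with h | h <;> rw [h]
    · rw [Set.mem_ofPred_eq, pauli_zero_one]
      exact S.one_mem
    · exact hv

theorem mem_pauliLabels {S : Subalgebra ℝ (Matrix (ι → ZMod 2) (ι → ZMod 2) A)}
    {v : (ι → ZMod 2) × (ι → ZMod 2)} : v ∈ pauliLabels S ↔ pauli v (1 : A) ∈ S := Iff.rfl

theorem eq_top_of_pauli_mem (S : Subalgebra ℝ (Matrix (ι → ZMod 2) (ι → ZMod 2) A))
    (hlabels : pauliLabels S = ⊤) (hscalar : ∀ a : A, pauli 0 a ∈ S) : S = ⊤ := by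
  refine eq_top_iff.mpr fun M _ => ?_
  rw [Matrix.matrix_eq_sum_single M]
  refine S.sum_mem fun i _ => S.sum_mem fun j _ => ?_
  rw [single_eq_smul_sum_pauli]
  refine S.smul_mem (S.sum_mem fun z _ => S.smul_mem ?_ _) _
  have hz : (i - j, z) ∈ pauliLabels S := hlabels ▸ Submodule.mem_top
  have h := S.mul_mem (hscalar (M i j)) (mem_pauliLabels.mp hz)
  rwa [pauli_mul_pauli, Prod.snd_zero, zero_dotProduct, zmodTwoSign_zero, one_smul, zero_add,
    mul_one] at h

/-- Labels of eight pairwise anticommuting real Pauli matrices on four factors, each of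
square `-1`. -/
def spinLabel : Fin 8 → (Fin 4 → ZMod 2) × (Fin 4 → ZMod 2) :=
  ![(![1, 0, 0, 0], ![1, 0, 0, 0]),
    (![0, 1, 0, 0], ![1, 1, 0, 0]),
    (![1, 1, 0, 0], ![0, 1, 1, 0]),
    (![0, 0, 1, 0], ![1, 1, 1, 0]),
    (![1, 0, 1, 0], ![0, 0, 1, 0]),
    (![0, 1, 1, 0], ![1, 0, 1, 0]),
    (![1, 1, 1, 0], ![0, 1, 0, 1]),
    (![1, 1, 1, 1], ![0, 1, 0, 0])]

/-- The label of the product of the eight matrices labelled by `spinLabel`. -/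
def volumeLabel : (Fin 4 → ZMod 2) × (Fin 4 → ZMod 2) :=
  (![1, 1, 1, 1], ![0, 1, 0, 1])

theorem spinLabel_dotProduct_self (i : Fin 8) : (spinLabel i).2 ⬝ᵥ (spinLabel i).1 = 1 := by
  decide +revert

theorem spinLabel_dotProduct_of_ne {i j : Fin 8} (h : i ≠ j) :
    (spinLabel i).2 ⬝ᵥ (spinLabel j).1 = (spinLabel j).2 ⬝ᵥ (spinLabel i).1 + 1 := by
  decide +revert

theorem volumeLabel_dotProduct_spinLabel (i : Fin 8) :
    volumeLabel.2 ⬝ᵥ (spinLabel i).1 = (spinLabel i).2 ⬝ᵥ volumeLabel.1 + 1 := by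
  decide +revert

theorem volumeLabel_dotProduct_self : volumeLabel.2 ⬝ᵥ volumeLabel.1 = 0 := by
  decide

theorem single_zero_eq_sum_spinLabel (i : Fin 4) :
    ((Pi.single i 1, 0) : (Fin 4 → ZMod 2) × (Fin 4 → ZMod 2)) =
      ∑ j ∈ (![{0, 1, 3, 5}, {0, 4, 5}, {2, 3, 4, 5}, {0, 1, 2, 3, 4, 5, 7}] :
        Fin 4 → Finset (Fin 8)) i, spinLabel j := by
  decide +revert

theorem zero_single_eq_sum_spinLabel (i : Fin 4) :
    ((0, Pi.single i 1) : (Fin 4 → ZMod 2) × (Fin 4 → ZMod 2)) =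
      ∑ j ∈ (![{1, 3, 5}, {0, 3, 4}, {0, 1, 2}, {0, 1, 2, 3, 4, 5, 6}] :
        Fin 4 → Finset (Fin 8)) i, spinLabel j := by
  decide +revert

theorem eq_top_of_spinLabel_mem
    (T : Submodule (ZMod 2) ((Fin 4 → ZMod 2) × (Fin 4 → ZMod 2)))
    (hT : ∀ j, spinLabel j ∈ T) : T = ⊤ := by
  refine eq_top_iff.mpr fun v _ => ?_
  have hv : v = ∑ i, v.1 i • ((Pi.single i 1, 0) : (Fin 4 → ZMod 2) × (Fin 4 → ZMod 2))
      + ∑ i, v.2 i • ((0, Pi.single i 1) : (Fin 4 → ZMod 2) × (Fin 4 → ZMod 2)) := by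
    refine Prod.ext ?_ ?_
    · simp [Prod.fst_sum, ← pi_eq_sum_univ']
    · simp [Prod.snd_sum, ← pi_eq_sum_univ']
  rw [hv]
  refine T.add_mem (T.sum_mem fun i _ => T.smul_mem _ ?_) (T.sum_mem fun i _ => T.smul_mem _ ?_)
  · rw [single_zero_eq_sum_spinLabel]
    exact T.sum_mem fun j _ => hT j
  · rw [zero_single_eq_sum_spinLabel]
    exact T.sum_mem fun j _ => hT j

theorem pauli_mul_add_swap_eq_zero {v w : (ι → ZMod 2) × (ι → ZMod 2)}
    (h : v.2 ⬝ᵥ w.1 = w.2 ⬝ᵥ v.1 + 1) {a b : A} (hab : Commute a b) :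
    pauli v a * pauli w b + pauli w b * pauli v a = 0 := by
  rw [pauli_mul_pauli, pauli_mul_pauli, h, zmodTwoSign_add, zmodTwoSign_one, add_comm w v,
    hab.eq, ← add_smul]
  simp

theorem pauli_mul_pauli_self (v : (ι → ZMod 2) × (ι → ZMod 2)) (a b : A) :
    pauli v a * pauli v b = zmodTwoSign (v.2 ⬝ᵥ v.1) • pauli 0 (a * b) := by
  have hv : v + v = 0 := by
    refine Prod.ext ?_ ?_ <;> ext i <;> exact CharTwo.add_self_eq_zero _
  rw [pauli_mul_pauli, hv]

end Pauli

namespace CliffordC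

/-- The images in `16 × 16` matrices over `C_k` of the standard generators of `C_{k+8}`. -/
noncomputable def periodicityGen (k : ℕ) :
    Fin (k + 8) → Matrix (Fin 4 → ZMod 2) (Fin 4 → ZMod 2) (CliffordC k) :=
  Fin.append (fun i => pauli volumeLabel (gen i)) (fun j => pauli (spinLabel j) 1)

theorem periodicityGen_mul_add_swap (k : ℕ) (i j : Fin (k + 8)) :
    periodicityGen k i * periodicityGen k j + periodicityGen k j * periodicityGen k i
      = if i = j then -2 else 0 := by
  have hscalar : pauli (0 : (Fin 4 → ZMod 2) × (Fin 4 → ZMod 2)) (-2 : CliffordC k) = -2 := by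
    rw [← algebraMap_neg_two, pauli_zero_algebraMap, algebraMap_neg_two]
  induction i using Fin.addCases with
  | left i =>
    induction j using Fin.addCases with
    | left j =>
      simp only [periodicityGen, Fin.append_left, Fin.castAdd_inj]
      rw [pauli_mul_pauli_self, pauli_mul_pauli_self, volumeLabel_dotProduct_self,
        zmodTwoSign_zero, one_smul, one_smul, ← map_add, gen_mul_add_swap]
      split_ifs
      · exact hscalar
      · exact map_zero _
    | right j =>
      have hne : Fin.castAdd 8 i ≠ Fin.natAdd k j := by simp [Fin.ext_iff]; omega
      simp only [periodicityGen, Fin.append_left, Fin.append_right, if_neg hne]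
      exact pauli_mul_add_swap_eq_zero (volumeLabel_dotProduct_spinLabel j) (Commute.one_right _)
  | right i =>
    induction j using Fin.addCases with
    | left j =>
      have hne : Fin.natAdd k i ≠ Fin.castAdd 8 j := by simp [Fin.ext_iff]; omega
      simp only [periodicityGen, Fin.append_left, Fin.append_right, if_neg hne]
      rw [add_comm]
      exact pauli_mul_add_swap_eq_zero (volumeLabel_dotProduct_spinLabel i) (Commute.one_right _)
    | right j =>
      simp only [periodicityGen, Fin.append_right, Fin.natAdd_inj]
      split_ifs with h
      · rw [h, pauli_mul_pauli_self, spinLabel_dotProduct_self, ← smul_add, ← map_add, ← hscalar,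
          zmodTwoSign_one, neg_one_smul, ← map_neg]
        norm_num
      · exact pauli_mul_add_swap_eq_zero (spinLabel_dotProduct_of_ne h) (Commute.one_right _)

theorem eq_top_of_periodicityGen_mem (k : ℕ)
    (S : Subalgebra ℝ (Matrix (Fin 4 → ZMod 2) (Fin 4 → ZMod 2) (CliffordC k)))
    (hS : ∀ i, periodicityGen k i ∈ S) : S = ⊤ := by
  have hlabels : pauliLabels S = ⊤ := eq_top_of_spinLabel_mem _ fun j => by
    simpa [periodicityGen, mem_pauliLabels] using hS (Fin.natAdd k j)
  have hvolume : volumeLabel ∈ pauliLabels S := hlabels ▸ Submodule.mem_top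
  let T : Subalgebra ℝ (CliffordC k) :=
    { carrier := {a | pauli 0 a ∈ S}
      mul_mem' := fun {a b} ha hb => by
        have h := S.mul_mem ha hb
        rwa [pauli_mul_pauli_self, Prod.snd_zero, zero_dotProduct, zmodTwoSign_zero,
          one_smul] at h
      add_mem' := fun {a b} ha hb => by
        rw [Set.mem_ofPred_eq, map_add]
        exact S.add_mem ha hb
      algebraMap_mem' := fun r => by
        rw [Set.mem_ofPred_eq, pauli_zero_algebraMap]
        exact S.algebraMap_mem r }
  refine eq_top_of_pauli_mem S hlabels (mem_of_gen_mem T fun i => ?_)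
  have hi : pauli volumeLabel (gen i) ∈ S := by
    simpa [periodicityGen] using hS (Fin.castAdd 8 i)
  have h := S.mul_mem hi (mem_pauliLabels.mp hvolume)
  rwa [pauli_mul_pauli_self, volumeLabel_dotProduct_self, zmodTwoSign_zero, one_smul,
    mul_one] at h

end CliffordC

/-- **8-fold periodicity of Clifford algebras.**
For every `k ≥ 0`, `C_{k+8}` is isomorphic as an `ℝ`-algebra to the algebra of
`16 × 16` matrices with entries in `C_k` (equivalently, `C_k ⊗ ℝ(16)`). -/
theorem cliffordAlgebra_periodicity (k : ℕ) :
    Nonempty (CliffordC (k + 8) ≃ₐ[ℝ] Matrix (Fin 16) (Fin 16) (CliffordC k)) := by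
  obtain ⟨φ, hφ⟩ := CliffordC.exists_algHom _ (CliffordC.periodicityGen_mul_add_swap k)
  have hsurj : Function.Surjective φ :=
    AlgHom.range_eq_top φ |>.mp <| CliffordC.eq_top_of_periodicityGen_mem k _ fun i =>
      ⟨CliffordC.gen i, hφ i⟩
  have hdim : Module.finrank ℝ (CliffordC (k + 8)) =
      Module.finrank ℝ (Matrix (Fin 4 → ZMod 2) (Fin 4 → ZMod 2) (CliffordC k)) := by
    rw [Module.finrank_matrix, CliffordC.finrank_eq, CliffordC.finrank_eq]
    simp [ZMod.card, pow_add, mul_comm]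
  have hinj : Function.Injective φ :=
    (LinearMap.injective_iff_surjective_of_finrank_eq_finrank (f := φ.toLinearMap) hdim).mpr hsurj
  have e : (Fin 4 → ZMod 2) ≃ Fin 16 := Fintype.equivFinOfCardEq (by simp [ZMod.card])
  exact ⟨(AlgEquiv.ofBijective φ ⟨hinj, hsurj⟩).trans (Matrix.reindexAlgEquiv ℝ _ e)⟩
end

section
/- For every integer k ≥ 0, the Clifford algebra C_k is, as a real algebra, isomorphic either to a full matrix algebra F(n) with F one of ℝ, ℂ, ℍ, or to the direct sum F(n) × F(n) of two copies of such a full matrix algebra; that is, there exist n ≥ 1 and F ∈ {ℝ, ℂ, ℍ} such that C_k ≅ F(n) or C_k ≅ F(n) × F(n). -/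
open scoped Quaternion

open scoped TensorProduct

section CliffordTensor

open CliffordAlgebra

variable {R M : Type*} [CommRing R] [AddCommGroup M] [Module R M]

/-- The linear map inducing `CliffordAlgebra.prodNegEquiv`. -/
noncomputable def CliffordAlgebra.prodNegLinear (c₁ c₂ : R) (Q : QuadraticForm R M) :
    (R × R) × M →ₗ[R] ℍ[R,c₁,0,c₂] ⊗[R] CliffordAlgebra Q :=
  LinearMap.coprod
    ((TensorProduct.mk R _ _).flip 1 ∘ₗ
      (LinearMap.coprod (LinearMap.toSpanSingleton R _ (QuaternionAlgebra.Basis.self R).i)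
        (LinearMap.toSpanSingleton R _ (QuaternionAlgebra.Basis.self R).j)))
    (TensorProduct.mk R _ _ (QuaternionAlgebra.Basis.self R).k ∘ₗ ι Q)

theorem CliffordAlgebra.prodNegLinear_apply (c₁ c₂ : R) (Q : QuadraticForm R M)
    (v : (R × R) × M) :
    prodNegLinear c₁ c₂ Q v =
      (⟨0, v.1.1, v.1.2, 0⟩ : ℍ[R,c₁,0,c₂]) ⊗ₜ 1 + (⟨0, 0, 0, 1⟩ : ℍ[R,c₁,0,c₂]) ⊗ₜ ι Q v.2 := by
  simp [prodNegLinear]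

/-- The forward map of `CliffordAlgebra.prodNegEquiv`. -/
noncomputable def CliffordAlgebra.prodNegToTensor {c₁ c₂ : R} (h : c₁ * c₂ = 1)
    (Q : QuadraticForm R M) :
    CliffordAlgebra ((CliffordAlgebraQuaternion.Q c₁ c₂).prod (-Q)) →ₐ[R]
      ℍ[R,c₁,0,c₂] ⊗[R] CliffordAlgebra Q :=
  CliffordAlgebra.lift _ ⟨prodNegLinear c₁ c₂ Q, fun v => by
    obtain ⟨⟨a, b⟩, w⟩ := v
    have h₁ : (⟨0, a, b, 0⟩ : ℍ[R,c₁,0,c₂]) * ⟨0, a, b, 0⟩ =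
        algebraMap R _ (c₁ * (a * a) + c₂ * (b * b)) := by
      ext <;> simp <;> ring
    have h₂ : (⟨0, a, b, 0⟩ : ℍ[R,c₁,0,c₂]) * ⟨0, 0, 0, 1⟩ =
        -(⟨0, 0, 0, 1⟩ * ⟨0, a, b, 0⟩) := by
      ext <;> simp
    have h₃ : (⟨0, 0, 0, 1⟩ : ℍ[R,c₁,0,c₂]) * ⟨0, 0, 0, 1⟩ = -1 := by
      ext <;> simp [h]
    rw [prodNegLinear_apply]
    simp only [add_mul, mul_add, Algebra.TensorProduct.tmul_mul_tmul, h₁, h₂, h₃, ι_sq_scalar,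
      one_mul, mul_one, QuadraticMap.prod_apply, _root_.neg_apply,
      CliffordAlgebraQuaternion.Q_apply, map_add, map_neg, TensorProduct.neg_tmul,
      Algebra.algebraMap_eq_smul_one, TensorProduct.add_tmul,
      ← TensorProduct.smul_tmul', TensorProduct.tmul_smul, Algebra.TensorProduct.one_def]
    module⟩

@[simp]
theorem CliffordAlgebra.prodNegToTensor_ι {c₁ c₂ : R} (h : c₁ * c₂ = 1)
    (Q : QuadraticForm R M) (v : (R × R) × M) :
    prodNegToTensor h Q (ι _ v) =
      (⟨0, v.1.1, v.1.2, 0⟩ : ℍ[R,c₁,0,c₂]) ⊗ₜ 1 + (⟨0, 0, 0, 1⟩ : ℍ[R,c₁,0,c₂]) ⊗ₜ ι Q v.2 := by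
  rw [prodNegToTensor, lift_ι_apply, prodNegLinear_apply]

/-- The quaternion basis given by the binary summand. -/
noncomputable def CliffordAlgebra.prodNegBasis (c₁ c₂ : R) (Q : QuadraticForm R M) :
    QuaternionAlgebra.Basis
      (CliffordAlgebra ((CliffordAlgebraQuaternion.Q c₁ c₂).prod (-Q))) c₁ 0 c₂ :=
  (CliffordAlgebraQuaternion.quaternionBasis c₁ c₂).compHom
    (CliffordAlgebra.map (QuadraticMap.Isometry.inl _ _))

@[simp]
theorem CliffordAlgebra.prodNegBasis_i (c₁ c₂ : R) (Q : QuadraticForm R M) :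
    (prodNegBasis c₁ c₂ Q).i = ι _ ((1, 0), 0) := by
  simp [prodNegBasis]

@[simp]
theorem CliffordAlgebra.prodNegBasis_j (c₁ c₂ : R) (Q : QuadraticForm R M) :
    (prodNegBasis c₁ c₂ Q).j = ι _ ((0, 1), 0) := by
  simp [prodNegBasis]

theorem CliffordAlgebra.prodNeg_anticommute (c₁ c₂ : R) (Q : QuadraticForm R M)
    (u : R × R) (w : M) :
    ι ((CliffordAlgebraQuaternion.Q c₁ c₂).prod (-Q)) (u, 0) * ι _ (0, w) =
      -(ι _ (0, w) * ι _ (u, 0)) := by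
  rw [eq_neg_iff_add_eq_zero, ι_mul_ι_add_swap]
  simp [QuadraticMap.polar]

theorem CliffordAlgebra.prodNegBasis_i_mul (c₁ c₂ : R) (Q : QuadraticForm R M) (w : M) :
    (prodNegBasis c₁ c₂ Q).i * ι _ (0, w) = -(ι _ (0, w) * (prodNegBasis c₁ c₂ Q).i) := by
  rw [prodNegBasis_i, prodNeg_anticommute]

theorem CliffordAlgebra.prodNegBasis_j_mul (c₁ c₂ : R) (Q : QuadraticForm R M) (w : M) :
    (prodNegBasis c₁ c₂ Q).j * ι _ (0, w) = -(ι _ (0, w) * (prodNegBasis c₁ c₂ Q).j) := by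
  rw [prodNegBasis_j, prodNeg_anticommute]

theorem CliffordAlgebra.prodNegBasis_k_mul (c₁ c₂ : R) (Q : QuadraticForm R M) (w : M) :
    (prodNegBasis c₁ c₂ Q).k * ι _ (0, w) = ι _ (0, w) * (prodNegBasis c₁ c₂ Q).k := by
  rw [← QuaternionAlgebra.Basis.i_mul_j, mul_assoc, prodNegBasis_j_mul, mul_neg, ← mul_assoc,
    prodNegBasis_i_mul, neg_mul, neg_neg, mul_assoc]

/-- The copy of the Clifford algebra of `Q` inside that of `c₁ x² + c₂ y² - Q` which commutes with
the quaternion algebra of the binary summand. -/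
noncomputable def CliffordAlgebra.prodNegInr {c₁ c₂ : R} (h : c₁ * c₂ = 1)
    (Q : QuadraticForm R M) :
    CliffordAlgebra Q →ₐ[R]
      CliffordAlgebra ((CliffordAlgebraQuaternion.Q c₁ c₂).prod (-Q)) :=
  CliffordAlgebra.lift Q
    ⟨-(LinearMap.mulLeft R (prodNegBasis c₁ c₂ Q).k ∘ₗ ι _ ∘ₗ LinearMap.inr R (R × R) M),
    fun w => by
      simp only [LinearMap.neg_apply, LinearMap.comp_apply, LinearMap.mulLeft_apply, neg_mul_neg,
        LinearMap.inr_apply]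
      rw [mul_assoc, ← mul_assoc (ι _ _), ← prodNegBasis_k_mul, mul_assoc, ι_sq_scalar, ← mul_assoc,
        QuaternionAlgebra.Basis.k_mul_k, h]
      simp⟩

@[simp]
theorem CliffordAlgebra.prodNegInr_ι {c₁ c₂ : R} (h : c₁ * c₂ = 1)
    (Q : QuadraticForm R M) (w : M) :
    prodNegInr h Q (ι Q w) = -((prodNegBasis c₁ c₂ Q).k * ι _ (0, w)) := by
  rw [prodNegInr, lift_ι_apply]
  rfl

theorem CliffordAlgebra.commute_prodNegBasis_prodNegInr {c₁ c₂ : R} (h : c₁ * c₂ = 1)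
    (Q : QuadraticForm R M) (x : ℍ[R,c₁,0,c₂]) (y : CliffordAlgebra Q) :
    Commute ((prodNegBasis c₁ c₂ Q).liftHom x) (prodNegInr h Q y) := by
  set q := prodNegBasis c₁ c₂ Q with hq
  have hi (w : M) : Commute q.i (q.k * ι _ (0, w)) := by
    rw [Commute, SemiconjBy, mul_assoc, ← neg_eq_iff_eq_neg.mpr (prodNegBasis_i_mul c₁ c₂ Q w),
      ← hq, mul_neg, ← mul_assoc, ← mul_assoc, q.i_mul_k, q.k_mul_i]
    simp
  have hj (w : M) : Commute q.j (q.k * ι _ (0, w)) := by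
    rw [Commute, SemiconjBy, mul_assoc, ← neg_eq_iff_eq_neg.mpr (prodNegBasis_j_mul c₁ c₂ Q w),
      ← hq, mul_neg, ← mul_assoc, ← mul_assoc, q.j_mul_k, q.k_mul_j]
    simp
  have hk (w : M) : Commute q.k (q.k * ι _ (0, w)) :=
    (Commute.refl _).mul_right (prodNegBasis_k_mul c₁ c₂ Q w)
  induction y using CliffordAlgebra.induction with
  | algebraMap r => rw [AlgHom.commutes]; exact Algebra.commute_algebraMap_right _ _
  | ι w =>
    rw [prodNegInr_ι, ← hq]
    refine Commute.neg_right ?_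
    rw [QuaternionAlgebra.Basis.liftHom_apply, QuaternionAlgebra.Basis.lift]
    exact (((Algebra.commute_algebraMap_left _ _).add_left ((hi w).smul_left _)).add_left
      ((hj w).smul_left _)).add_left ((hk w).smul_left _)
  | mul a b ha hb => rw [map_mul]; exact ha.mul_right hb
  | add a b ha hb => rw [map_add]; exact ha.add_right hb

/-- If `c₁ * c₂ = 1`, the Clifford algebra of `c₁ x² + c₂ y² - Q` is the tensor product of the
quaternion algebra `ℍ[R,c₁,0,c₂]` and the Clifford algebra of `Q`. -/
noncomputable def CliffordAlgebra.prodNegEquiv {c₁ c₂ : R} (h : c₁ * c₂ = 1)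
    (Q : QuadraticForm R M) :
    CliffordAlgebra ((CliffordAlgebraQuaternion.Q c₁ c₂).prod (-Q)) ≃ₐ[R]
      ℍ[R,c₁,0,c₂] ⊗[R] CliffordAlgebra Q :=
  AlgEquiv.ofAlgHom (prodNegToTensor h Q)
    (Algebra.TensorProduct.lift (prodNegBasis c₁ c₂ Q).liftHom (prodNegInr h Q)
      (commute_prodNegBasis_prodNegInr h Q))
    (by
      have hk : prodNegToTensor h Q (prodNegBasis c₁ c₂ Q).k =
          (⟨0, 0, 0, 1⟩ : ℍ[R,c₁,0,c₂]) ⊗ₜ 1 := by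
        rw [← QuaternionAlgebra.Basis.i_mul_j]
        simp
      have h₀ : (⟨0, 0, 0, 0⟩ : ℍ[R,c₁,0,c₂]) = 0 := rfl
      ext
      · simp [QuaternionAlgebra.Basis.lift]
      · simp [QuaternionAlgebra.Basis.lift]
      · have h₃ : (⟨0, 0, 0, 1⟩ : ℍ[R,c₁,0,c₂]) * ⟨0, 0, 0, 1⟩ = -1 := by
          ext <;> simp [h]
        simp [-QuaternionAlgebra.Basis.liftHom_apply, hk, h₀, h₃, TensorProduct.neg_tmul])
    (by
      ext w
      · simp [QuaternionAlgebra.Basis.lift]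
      · simp [QuaternionAlgebra.Basis.lift]
      · simp [QuaternionAlgebra.Basis.lift, ← mul_assoc, h])

end CliffordTensor

section SplitQuaternions

/-- The split quaternions are the real `2 × 2` matrices. -/
noncomputable def splitQuaternionEquivMatrix : ℍ[ℝ,1,0,1] ≃ₐ[ℝ] Matrix (Fin 2) (Fin 2) ℝ where
  toFun x := !![x.re + x.imI, x.imJ + x.imK; x.imJ - x.imK, x.re - x.imI]
  invFun m := ⟨(m 0 0 + m 1 1) / 2, (m 0 0 - m 1 1) / 2, (m 0 1 + m 1 0) / 2, (m 0 1 - m 1 0) / 2⟩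
  left_inv x := by ext <;> simp
  right_inv m := by ext i j; fin_cases i <;> fin_cases j <;> simp <;> ring
  map_mul' x y := by ext i j; fin_cases i <;> fin_cases j <;> simp [Matrix.mul_apply] <;> ring
  map_add' x y := by ext i j; fin_cases i <;> fin_cases j <;> simp <;> ring
  commutes' r := by
    ext i j; fin_cases i <;> fin_cases j <;> simp [Matrix.algebraMap_matrix_apply]

/-- `ℍ ⊗ ℍ` is the tensor square of the split quaternions: both are the Clifford algebra of a
real form of signature `(2, 2)`. -/
noncomputable def quaternionTensorEquivSplit :
    ℍ[ℝ,-1,0,-1] ⊗[ℝ] ℍ[ℝ,-1,0,-1] ≃ₐ[ℝ] ℍ[ℝ,1,0,1] ⊗[ℝ] ℍ[ℝ,1,0,1] :=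
  let e : QuadraticMap.IsometryEquiv
      ((CliffordAlgebraQuaternion.Q (-1 : ℝ) (-1)).prod (-CliffordAlgebraQuaternion.Q (-1) (-1)))
      ((CliffordAlgebraQuaternion.Q (1 : ℝ) 1).prod (-CliffordAlgebraQuaternion.Q 1 1)) :=
    { LinearEquiv.prodComm ℝ (ℝ × ℝ) (ℝ × ℝ) with
      map_app' := fun v => by simp; ring }
  (Algebra.TensorProduct.congr .refl CliffordAlgebraQuaternion.equiv).symm.trans <|
    (CliffordAlgebra.prodNegEquiv (by norm_num) _).symm.trans <|
      (CliffordAlgebra.equivOfIsometry e).trans <|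
        (CliffordAlgebra.prodNegEquiv (by norm_num) _).trans <|
          Algebra.TensorProduct.congr .refl CliffordAlgebraQuaternion.equiv

/-- The Pauli-type quaternion basis of the complex `2 × 2` matrices. -/
noncomputable def complexMatrixQuaternionBasis :
    QuaternionAlgebra.Basis (Matrix (Fin 2) (Fin 2) ℂ) (-1 : ℝ) 0 (-1) where
  i := !![Complex.I, 0; 0, -Complex.I]
  j := !![0, 1; -1, 0]
  k := !![0, Complex.I; Complex.I, 0]
  i_mul_i := by ext i j; fin_cases i <;> fin_cases j <;> simp [Matrix.mul_apply]
  j_mul_j := by ext i j; fin_cases i <;> fin_cases j <;> simp [Matrix.mul_apply]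
  i_mul_j := by ext i j; fin_cases i <;> fin_cases j <;> simp [Matrix.mul_apply]
  j_mul_i := by ext i j; fin_cases i <;> fin_cases j <;> simp [Matrix.mul_apply]

/-- The complexification map `ℍ ⊗ ℂ → ℂ(2)`. -/
noncomputable def quaternionTensorComplexToMatrix :
    ℍ[ℝ,-1,0,-1] ⊗[ℝ] ℂ →ₐ[ℝ] Matrix (Fin 2) (Fin 2) ℂ :=
  Algebra.TensorProduct.lift complexMatrixQuaternionBasis.liftHom
    (IsScalarTower.toAlgHom ℝ ℂ (Matrix (Fin 2) (Fin 2) ℂ))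
    fun _ z => by
      rw [IsScalarTower.coe_toAlgHom']
      exact Algebra.commute_algebraMap_right z _

theorem quaternionTensorComplexToMatrix_tmul (x : ℍ[ℝ,-1,0,-1]) (z : ℂ) :
    quaternionTensorComplexToMatrix (x ⊗ₜ z) = z • complexMatrixQuaternionBasis.lift x := by
  rw [quaternionTensorComplexToMatrix, Algebra.TensorProduct.lift_tmul,
    IsScalarTower.coe_toAlgHom', ← Algebra.commutes, ← Algebra.smul_def]
  rfl

theorem quaternionTensorComplexToMatrix_bijective :
    Function.Bijective quaternionTensorComplexToMatrix := by
  have hs : Function.Surjective quaternionTensorComplexToMatrix := fun m => by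
    refine ⟨(1 : ℍ[ℝ,-1,0,-1]) ⊗ₜ ((m 0 0 + m 1 1) / 2) +
      (⟨0, 1, 0, 0⟩ : ℍ[ℝ,-1,0,-1]) ⊗ₜ (-Complex.I * (m 0 0 - m 1 1) / 2) +
      (⟨0, 0, 1, 0⟩ : ℍ[ℝ,-1,0,-1]) ⊗ₜ ((m 0 1 - m 1 0) / 2) +
      (⟨0, 0, 0, 1⟩ : ℍ[ℝ,-1,0,-1]) ⊗ₜ (-Complex.I * (m 0 1 + m 1 0) / 2), ?_⟩
    ext i j
    fin_cases i <;> fin_cases j <;>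
      simp [quaternionTensorComplexToMatrix_tmul, complexMatrixQuaternionBasis,
        QuaternionAlgebra.Basis.lift] <;>
      ring_nf <;> simp <;> ring
  have hd : Module.finrank ℝ (ℍ[ℝ,-1,0,-1] ⊗[ℝ] ℂ) =
      Module.finrank ℝ (Matrix (Fin 2) (Fin 2) ℂ) := by
    rw [Module.finrank_tensorProduct, Module.finrank_matrix, QuaternionAlgebra.finrank_eq_four,
      Complex.finrank_real_complex]
    simp
  exact ⟨(LinearMap.injective_iff_surjective_of_finrank_eq_finrank
    (f := quaternionTensorComplexToMatrix.toLinearMap) hd).mpr hs, hs⟩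

end SplitQuaternions

section FullMatrixAlgebras

variable {A B : Type*} [Ring A] [Algebra ℝ A] [Ring B] [Algebra ℝ B]

/-- A real algebra is a full matrix algebra `F(n)` with `n ≥ 1` and `F` one of `ℝ`, `ℂ`, `ℍ`. -/
def IsFullRealMatrixAlgebra (A : Type*) [Ring A] [Algebra ℝ A] : Prop :=
  ∃ n : ℕ, 1 ≤ n ∧
    (Nonempty (A ≃ₐ[ℝ] Matrix (Fin n) (Fin n) ℝ) ∨
     Nonempty (A ≃ₐ[ℝ] Matrix (Fin n) (Fin n) ℂ) ∨
     Nonempty (A ≃ₐ[ℝ] Matrix (Fin n) (Fin n) ℍ[ℝ]))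

namespace IsFullRealMatrixAlgebra

theorem congr (e : A ≃ₐ[ℝ] B) (h : IsFullRealMatrixAlgebra B) : IsFullRealMatrixAlgebra A := by
  obtain ⟨n, hn, h⟩ := h
  rcases h with ⟨⟨f⟩⟩ | ⟨⟨f⟩⟩ | ⟨⟨f⟩⟩
  · exact ⟨n, hn, .inl ⟨e.trans f⟩⟩
  · exact ⟨n, hn, .inr (.inl ⟨e.trans f⟩)⟩
  · exact ⟨n, hn, .inr (.inr ⟨e.trans f⟩)⟩

/-- The `1 × 1` matrices over an algebra. -/
def finOneMatrixEquiv (F : Type*) [Ring F] [Algebra ℝ F] : F ≃ₐ[ℝ] Matrix (Fin 1) (Fin 1) F where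
  toFun a := Matrix.of fun _ _ => a
  invFun m := m 0 0
  left_inv _ := rfl
  right_inv m := by ext i j; rw [Subsingleton.elim i 0, Subsingleton.elim j 0]; rfl
  map_mul' a b := by ext; simp [Matrix.mul_apply]
  map_add' a b := rfl
  commutes' r := by ext i j; simp [Matrix.algebraMap_matrix_apply, Subsingleton.elim i j]

theorem real : IsFullRealMatrixAlgebra ℝ :=
  ⟨1, le_rfl, .inl ⟨finOneMatrixEquiv _⟩⟩

theorem complex : IsFullRealMatrixAlgebra ℂ :=
  ⟨1, le_rfl, .inr (.inl ⟨finOneMatrixEquiv _⟩)⟩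

theorem quaternion : IsFullRealMatrixAlgebra ℍ[ℝ] :=
  ⟨1, le_rfl, .inr (.inr ⟨finOneMatrixEquiv _⟩)⟩

/-- A matrix algebra over a matrix algebra is a matrix algebra. -/
noncomputable def matrixMatrixEquiv (F : Type*) [Ring F] [Algebra ℝ F] (m n : ℕ) :
    Matrix (Fin m) (Fin m) (Matrix (Fin n) (Fin n) F) ≃ₐ[ℝ] Matrix (Fin (m * n)) (Fin (m * n)) F :=
  (Matrix.compAlgEquiv (Fin m) (Fin n) F ℝ).trans (Matrix.reindexAlgEquiv ℝ F finProdFinEquiv)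

theorem matrix (h : IsFullRealMatrixAlgebra A) {m : ℕ} (hm : 1 ≤ m) :
    IsFullRealMatrixAlgebra (Matrix (Fin m) (Fin m) A) := by
  obtain ⟨n, hn, h⟩ := h
  rcases h with ⟨⟨f⟩⟩ | ⟨⟨f⟩⟩ | ⟨⟨f⟩⟩
  · exact ⟨m * n, Nat.mul_pos hm hn, .inl ⟨f.mapMatrix.trans (matrixMatrixEquiv _ m n)⟩⟩
  · exact ⟨m * n, Nat.mul_pos hm hn, .inr (.inl ⟨f.mapMatrix.trans (matrixMatrixEquiv _ m n)⟩)⟩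
  · exact ⟨m * n, Nat.mul_pos hm hn, .inr (.inr ⟨f.mapMatrix.trans (matrixMatrixEquiv _ m n)⟩)⟩

/-- Tensoring a matrix algebra on the left. -/
noncomputable def tensorMatrixEquiv (B F : Type*) [Ring B] [Algebra ℝ B] [Ring F] [Algebra ℝ F]
    (n : ℕ) :
    B ⊗[ℝ] Matrix (Fin n) (Fin n) F ≃ₐ[ℝ] Matrix (Fin n) (Fin n) (B ⊗[ℝ] F) :=
  (Algebra.TensorProduct.congr .refl (matrixEquivTensor (Fin n) ℝ F)).trans <|
    (Algebra.TensorProduct.assoc ℝ ℝ ℝ B F (Matrix (Fin n) (Fin n) ℝ)).symm.trans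
      (matrixEquivTensor (Fin n) ℝ (B ⊗[ℝ] F)).symm

theorem tensor_of_scalars (hR : IsFullRealMatrixAlgebra (B ⊗[ℝ] ℝ))
    (hC : IsFullRealMatrixAlgebra (B ⊗[ℝ] ℂ)) (hH : IsFullRealMatrixAlgebra (B ⊗[ℝ] ℍ[ℝ]))
    (h : IsFullRealMatrixAlgebra A) : IsFullRealMatrixAlgebra (B ⊗[ℝ] A) := by
  obtain ⟨n, hn, h⟩ := h
  rcases h with ⟨⟨f⟩⟩ | ⟨⟨f⟩⟩ | ⟨⟨f⟩⟩
  · exact congr ((Algebra.TensorProduct.congr .refl f).trans (tensorMatrixEquiv B _ n))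
      (hR.matrix hn)
  · exact congr ((Algebra.TensorProduct.congr .refl f).trans (tensorMatrixEquiv B _ n))
      (hC.matrix hn)
  · exact congr ((Algebra.TensorProduct.congr .refl f).trans (tensorMatrixEquiv B _ n))
      (hH.matrix hn)

theorem splitQuaternion_tensor (h : IsFullRealMatrixAlgebra A) :
    IsFullRealMatrixAlgebra (ℍ[ℝ,1,0,1] ⊗[ℝ] A) :=
  congr ((Algebra.TensorProduct.congr splitQuaternionEquivMatrix .refl).trans <|
    (Algebra.TensorProduct.comm ℝ _ A).trans (matrixEquivTensor (Fin 2) ℝ A).symm)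
    (h.matrix one_le_two)

theorem quaternion_tensor (h : IsFullRealMatrixAlgebra A) :
    IsFullRealMatrixAlgebra (ℍ[ℝ,-1,0,-1] ⊗[ℝ] A) := by
  refine tensor_of_scalars ?_ ?_ ?_ h
  · exact congr (Algebra.TensorProduct.rid ℝ ℝ _) quaternion
  · exact congr (AlgEquiv.ofBijective _ quaternionTensorComplexToMatrix_bijective)
      (complex.matrix one_le_two)
  · exact congr quaternionTensorEquivSplit
      (splitQuaternion_tensor (congr splitQuaternionEquivMatrix (real.matrix one_le_two)))

end IsFullRealMatrixAlgebra

/-- A real algebra is a full matrix algebra over `ℝ`, `ℂ` or `ℍ`, or the product of two copies of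
one. -/
def IsRealMatrixAlgebraOrDouble (A : Type*) [Ring A] [Algebra ℝ A] : Prop :=
  IsFullRealMatrixAlgebra A ∨
    ∃ (B : Type) (_ : Ring B) (_ : Algebra ℝ B),
      IsFullRealMatrixAlgebra B ∧ Nonempty (A ≃ₐ[ℝ] B × B)

namespace IsRealMatrixAlgebraOrDouble

theorem congr (e : A ≃ₐ[ℝ] B) (h : IsRealMatrixAlgebraOrDouble B) :
    IsRealMatrixAlgebraOrDouble A := by
  obtain h | ⟨C, _, _, hC, ⟨f⟩⟩ := h
  · exact .inl (h.congr e)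
  · exact .inr ⟨C, _, _, hC, ⟨e.trans f⟩⟩

theorem tensor {B : Type} [Ring B] [Algebra ℝ B]
    (hB : ∀ (A : Type) [Ring A] [Algebra ℝ A],
      IsFullRealMatrixAlgebra A → IsFullRealMatrixAlgebra (B ⊗[ℝ] A))
    {A : Type} [Ring A] [Algebra ℝ A] (h : IsRealMatrixAlgebraOrDouble A) :
    IsRealMatrixAlgebraOrDouble (B ⊗[ℝ] A) := by
  obtain h | ⟨C, _, _, hC, ⟨f⟩⟩ := h
  · exact .inl (hB A h)
  · exact .inr ⟨B ⊗[ℝ] C, _, _, hB C hC, ⟨(Algebra.TensorProduct.congr .refl f).trans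
      (Algebra.TensorProduct.prodRight ℝ ℝ B C C)⟩⟩

end IsRealMatrixAlgebraOrDouble

end FullMatrixAlgebras

section DefiniteForms

open CliffordAlgebra

/-- The map `CliffordAlgebra.sqEquivProd`, sending the generator to `(1, -1)`. -/
noncomputable def CliffordAlgebra.sqToProd :
    CliffordAlgebra (QuadraticMap.sq : QuadraticForm ℝ ℝ) →ₐ[ℝ] ℝ × ℝ :=
  CliffordAlgebra.lift _ ⟨LinearMap.toSpanSingleton ℝ (ℝ × ℝ) (1, -1), fun r => by ext <;> simp⟩

@[simp]
theorem CliffordAlgebra.sqToProd_ι (r : ℝ) : sqToProd (ι _ r) = (r, -r) := by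
  rw [sqToProd, lift_ι_apply]
  simp

/-- The Clifford algebra of `x²` on `ℝ` is `ℝ × ℝ`. -/
noncomputable def CliffordAlgebra.sqEquivProd :
    CliffordAlgebra (QuadraticMap.sq : QuadraticForm ℝ ℝ) ≃ₐ[ℝ] ℝ × ℝ :=
  AlgEquiv.ofAlgHom
    sqToProd
    (AlgHom.ofLinearMap
      (LinearMap.coprod (LinearMap.toSpanSingleton ℝ _ ((1 / 2 : ℝ) • (1 + ι _ 1)))
        (LinearMap.toSpanSingleton ℝ _ ((1 / 2 : ℝ) • (1 - ι _ 1))))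
      (by simp; module)
      (fun x y => by
        have h : ι (QuadraticMap.sq : QuadraticForm ℝ ℝ) 1 * ι _ 1 = 1 := by
          rw [ι_sq_scalar]; simp
        simp only [LinearMap.coprod_apply, LinearMap.toSpanSingleton_apply, add_mul, mul_add,
          sub_mul, mul_sub, smul_mul_assoc, mul_smul_comm, one_mul, mul_one, h, Prod.fst_mul,
          Prod.snd_mul]
        module))
    (by ext <;> simp <;> ring)
    (by ext; simp; module)

/-- Splitting two coordinates off a definite form. -/
def definiteFormSplit (ε : ℝ) (k : ℕ) : QuadraticMap.IsometryEquiv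
    (QuadraticMap.weightedSumSquares ℝ (fun _ : Fin (k + 2) => ε))
    ((CliffordAlgebraQuaternion.Q ε ε).prod
      (-QuadraticMap.weightedSumSquares ℝ (fun _ : Fin k => -ε))) where
  toFun v := ((v 0, v 1), fun i => v i.succ.succ)
  invFun w := Fin.cons w.1.1 (Fin.cons w.1.2 w.2)
  left_inv v := by
    ext i
    refine Fin.cases rfl (fun i => ?_) i
    exact Fin.cases rfl (fun _ => rfl) i
  right_inv w := rfl
  map_add' _ _ := rfl
  map_smul' _ _ := rfl
  map_app' v := by
    simp [QuadraticMap.weightedSumSquares_apply, Fin.sum_univ_succ, add_assoc]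

/-- A definite form in one variable. -/
def definiteFormOne (ε : ℝ) : QuadraticMap.IsometryEquiv
    (QuadraticMap.weightedSumSquares ℝ (fun _ : Fin 1 => ε)) (ε • QuadraticMap.sq) where
  __ := LinearEquiv.funUnique (Fin 1) ℝ ℝ
  map_app' v := by simp [QuadraticMap.weightedSumSquares_apply]

/-- The form in no variables. -/
def definiteFormZero (ε : ℝ) : QuadraticMap.IsometryEquiv
    (QuadraticMap.weightedSumSquares ℝ (fun _ : Fin 0 => ε)) (0 : QuadraticForm ℝ Unit) where
  toFun _ := 0
  invFun _ := 0
  left_inv _ := Subsingleton.elim _ _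
  right_inv _ := rfl
  map_add' _ _ := rfl
  map_smul' _ _ := rfl
  map_app' v := by simp [QuadraticMap.weightedSumSquares_apply]

theorem isRealMatrixAlgebraOrDouble_cliffordAlgebra (k : ℕ) :
    IsRealMatrixAlgebraOrDouble
        (CliffordAlgebra (QuadraticMap.weightedSumSquares ℝ (fun _ : Fin k => (-1 : ℝ)))) ∧
      IsRealMatrixAlgebraOrDouble
        (CliffordAlgebra (QuadraticMap.weightedSumSquares ℝ (fun _ : Fin k => (1 : ℝ)))) := by
  induction k using Nat.twoStepInduction with
  | zero =>
    have h (ε : ℝ) : IsRealMatrixAlgebraOrDouble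
        (CliffordAlgebra (QuadraticMap.weightedSumSquares ℝ (fun _ : Fin 0 => ε))) :=
      .inl (.congr ((equivOfIsometry (definiteFormZero ε)).trans CliffordAlgebraRing.equiv) .real)
    exact ⟨h _, h _⟩
  | one =>
    have hneg : (-1 : ℝ) • (QuadraticMap.sq : QuadraticForm ℝ ℝ) = CliffordAlgebraComplex.Q := by
      ext; simp
    refine ⟨.inl (.congr ((equivOfIsometry ((definiteFormOne (-1)).trans ?_)).trans
      CliffordAlgebraComplex.equiv) .complex), .inr ⟨ℝ, _, _, .real,
        ⟨(equivOfIsometry ((definiteFormOne 1).trans ?_)).trans sqEquivProd⟩⟩⟩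
    · rw [hneg]
      exact .refl _
    · rw [one_smul]
      exact .refl _
  | more k h _ =>
    refine ⟨.congr ((equivOfIsometry (definiteFormSplit (-1) k)).trans
      (prodNegEquiv (by norm_num) _)) (.tensor (fun A _ _ => .quaternion_tensor) ?_),
      .congr ((equivOfIsometry (definiteFormSplit 1 k)).trans
      (prodNegEquiv (by norm_num) _)) (.tensor (fun A _ _ => .splitQuaternion_tensor) h.1)⟩
    rw [neg_neg]
    exact h.2

end DefiniteForms

/-- **Clifford algebras are (sums of) full matrix algebras.**
For every `k ≥ 0` there exist `n ≥ 1` and `F ∈ {ℝ, ℂ, ℍ}` such that `C_k` is isomorphic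
as a real algebra either to the full matrix algebra `F(n)` or to `F(n) × F(n)`. -/
theorem cliffordC_classification (k : ℕ) :
    ∃ n : ℕ, 1 ≤ n ∧
      (Nonempty (CliffordC k ≃ₐ[ℝ] Matrix (Fin n) (Fin n) ℝ) ∨
       Nonempty (CliffordC k ≃ₐ[ℝ] Matrix (Fin n) (Fin n) ℂ) ∨
       Nonempty (CliffordC k ≃ₐ[ℝ] Matrix (Fin n) (Fin n) ℍ[ℝ]) ∨
       Nonempty (CliffordC k ≃ₐ[ℝ] (Matrix (Fin n) (Fin n) ℝ × Matrix (Fin n) (Fin n) ℝ)) ∨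
       Nonempty (CliffordC k ≃ₐ[ℝ] (Matrix (Fin n) (Fin n) ℂ × Matrix (Fin n) (Fin n) ℂ)) ∨
       Nonempty (CliffordC k ≃ₐ[ℝ] (Matrix (Fin n) (Fin n) ℍ[ℝ] × Matrix (Fin n) (Fin n) ℍ[ℝ]))) := by
  obtain ⟨n, hn, h⟩ | ⟨B, _, _, ⟨n, hn, h⟩, ⟨e⟩⟩ :=
    (isRealMatrixAlgebraOrDouble_cliffordAlgebra k).1
  · refine ⟨n, hn, ?_⟩
    rcases h with h | h | h
    · exact .inl h
    · exact .inr (.inl h)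
    · exact .inr (.inr (.inl h))
  · refine ⟨n, hn, ?_⟩
    rcases h with ⟨⟨f⟩⟩ | ⟨⟨f⟩⟩ | ⟨⟨f⟩⟩
    · exact .inr (.inr (.inr (.inl ⟨e.trans (f.prodCongr f)⟩)))
    · exact .inr (.inr (.inr (.inr (.inl ⟨e.trans (f.prodCongr f)⟩))))
    · exact .inr (.inr (.inr (.inr (.inr ⟨e.trans (f.prodCongr f)⟩))))
end

section
/- (Picard's little theorem.) Let f : ℂ → ℂ be an entire function. If there exist two distinct complex numbers a ≠ b such that neither a nor b lies in the range of f, then f is constant. (Equivalently, in the paper's formulation: a nonconstant holomorphic map from ℂ to the Riemann sphere ℂP¹ cannot miss more than two points, since a holomorphic map into ℂP¹ omitting the point ∞ is an entire function.) -/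
open Complex Metric Set Filter Topology

/-- A nowhere vanishing entire function has an entire logarithm. -/
theorem Complex.exists_differentiable_exp_eq {f : ℂ → ℂ} (hf : Differentiable ℂ f)
    (h0 : ∀ z, f z ≠ 0) :
    ∃ g : ℂ → ℂ, Differentiable ℂ g ∧ ∀ z, exp (g z) = f z := by
  have hd : Differentiable ℂ (fun z ↦ deriv f z / f z) :=
    Differentiable.div (fun z ↦ hf.analyticAt z |>.deriv.differentiableAt) hf h0
  obtain ⟨g, hg0, hg⟩ := hd.isExactOn_univ.with_val_at 0 (log (f 0))
  have hgd : Differentiable ℂ g := fun z ↦ (hg z (mem_univ z)).differentiableAt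
  refine ⟨g, hgd, fun z ↦ ?_⟩
  have hderiv : ∀ w, HasDerivAt (fun w ↦ f w * exp (-g w)) 0 w := fun w ↦ by
    refine ((hf w).hasDerivAt.mul (hg w (mem_univ w)).neg.cexp).congr_deriv ?_
    have := h0 w
    field_simp
    ring
  have hconst := is_const_of_deriv_eq_zero (fun w ↦ (hderiv w).differentiableAt)
    (fun w ↦ (hderiv w).deriv) z 0
  simp only [hg0, exp_neg, exp_log (h0 0), mul_inv_cancel₀ (h0 0)] at hconst
  exact (eq_of_mul_inv_eq_one hconst).symm

/-- An entire function omitting `1` and `-1` is the cosine of an entire function. -/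
theorem Complex.exists_differentiable_cos_eq {f : ℂ → ℂ} (hf : Differentiable ℂ f)
    (h1 : ∀ z, f z ≠ 1) (h2 : ∀ z, f z ≠ -1) :
    ∃ g : ℂ → ℂ, Differentiable ℂ g ∧ ∀ z, cos (g z) = f z := by
  obtain ⟨l, hl, hl'⟩ := exists_differentiable_exp_eq (f := fun z ↦ 1 - f z ^ 2) (by fun_prop)
    fun z h ↦ by
      rcases sq_eq_one_iff.mp (sub_eq_zero.mp h).symm with h | h
      exacts [h1 z h, h2 z h]
  have hs : ∀ z, exp (l z / 2) ^ 2 = 1 - f z ^ 2 := fun z ↦ by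
    rw [← hl' z, ← exp_nat_mul]
    congr 1
    push_cast
    ring
  have hprod : ∀ z, (f z + I * exp (l z / 2)) * (f z - I * exp (l z / 2)) = 1 := fun z ↦ by
    linear_combination hs z - exp (l z / 2) ^ 2 * I_sq
  obtain ⟨k, hk, hk'⟩ := exists_differentiable_exp_eq (f := fun z ↦ f z + I * exp (l z / 2))
    (by fun_prop) fun z ↦ left_ne_zero_of_mul_eq_one (hprod z)
  refine ⟨fun z ↦ -I * k z, by fun_prop, fun z ↦ ?_⟩
  have e1 : -I * k z * I = k z := by linear_combination -k z * I_sq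
  have e2 : -(-I * k z) * I = -k z := by linear_combination k z * I_sq
  rw [cos, e1, e2, exp_neg, hk', inv_eq_of_mul_eq_one_right (hprod z)]
  ring

/-- A weak form of **Bloch's theorem** for entire functions. -/
theorem Complex.exists_ball_subset_range_of_differentiable {g : ℂ → ℂ} (hg : Differentiable ℂ g)
    (c : ℂ)
    {R : ℝ} (hR : 0 < R) : ∃ w, ball w (R * ‖deriv g c‖ / 48) ⊆ range g := by
  rcases eq_or_ne (deriv g c) 0 with h0 | h0
  · exact ⟨0, by simp [h0]⟩
  have hd : Differentiable ℂ (deriv g) := fun z ↦ (hg.analyticAt z).deriv.differentiableAt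
  have hcont : Continuous fun z ↦ ‖deriv g z‖ * (R - dist z c) := by
    have := hd.continuous
    fun_prop
  obtain ⟨p, hp, hmax⟩ := (isCompact_closedBall c R).exists_isMaxOn
    ⟨c, mem_closedBall_self hR.le⟩ hcont.continuousOn
  have hmax' : ∀ z ∈ closedBall c R,
      ‖deriv g z‖ * (R - dist z c) ≤ ‖deriv g p‖ * (R - dist p c) := fun z hz ↦ hmax hz
  have hc := hmax' c (mem_closedBall_self hR.le)
  simp only [dist_self, sub_zero] at hc
  have hc0 : 0 < ‖deriv g c‖ * R := by positivity
  set A := ‖deriv g p‖ with hA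
  obtain ⟨t, ht⟩ : ∃ t, R - dist p c = 2 * t := ⟨(R - dist p c) / 2, by ring⟩
  rw [ht] at hc
  have ht0 : 0 < t := by
    have : 0 ≤ A := norm_nonneg _
    by_contra! h
    nlinarith
  have hA0 : 0 < A := by
    by_contra! h
    nlinarith
  have hbound : ∀ z ∈ ball p t, ‖deriv g z‖ ≤ 2 * A := fun z hz ↦ by
    have h1 : dist z c ≤ dist z p + dist p c := dist_triangle z p c
    have h2 : dist z p < t := hz
    have h3 := hmax' z (mem_closedBall.mpr (by linarith))
    rw [ht] at h3
    have h4 : ‖deriv g z‖ * t ≤ ‖deriv g z‖ * (R - dist z c) := by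
      gcongr
      linarith
    refine le_of_mul_le_mul_right ?_ ht0
    linarith
  have hmaps : MapsTo (deriv g) (ball p t) (closedBall (deriv g p) (3 * A)) := fun z hz ↦ by
    rw [mem_closedBall, dist_eq_norm]
    linarith [norm_sub_le (deriv g z) (deriv g p), hbound z hz]
  have hschwarz : ∀ z ∈ closedBall p (t / 6), ‖deriv g z - deriv g p‖ ≤ A / 2 := fun z hz ↦ by
    have hz' : z ∈ ball p t := closedBall_subset_ball (by linarith) hz
    have := dist_le_div_mul_dist_of_mapsTo_ball hd.differentiableOn hmaps hz'
    rw [dist_eq_norm] at this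
    calc _ ≤ 3 * A / t * dist z p := this
      _ ≤ 3 * A / t * (t / 6) := by
        gcongr
        exact hz
      _ = A / 2 := by field_simp; norm_num
  have hsphere : ∀ z ∈ sphere p (t / 6), A * t / 12 ≤ ‖g z - g p‖ := fun z hz ↦ by
    have hder : ∀ w, HasDerivAt (fun w ↦ g w - deriv g p * w) (deriv g w - deriv g p) w :=
      fun w ↦ ((hg w).hasDerivAt.sub ((hasDerivAt_id w).const_mul (deriv g p))).congr_deriv
        (by rw [mul_one])
    have h1 := (convex_closedBall p (t / 6)).norm_image_sub_le_of_norm_deriv_le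
      (fun w _ ↦ (hder w).differentiableAt)
      (fun w hw ↦ (hder w).deriv ▸ hschwarz w hw)
      (mem_closedBall_self (by positivity)) (sphere_subset_closedBall hz)
    have h2 : ‖z - p‖ = t / 6 := by rwa [mem_sphere, dist_eq_norm] at hz
    have h3 : ‖deriv g p * (z - p)‖ = A * (t / 6) := by rw [norm_mul, h2]
    have h4 := norm_sub_le (g z - g p) (g z - deriv g p * z - (g p - deriv g p * p))
    rw [show g z - g p - (g z - deriv g p * z - (g p - deriv g p * p)) = deriv g p * (z - p) by
      ring] at h4
    rw [h2] at h1
    linarith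
  have hfreq : ∃ᶠ z in 𝓝 p, g z ≠ g p := fun h ↦ by
    have h' : g =ᶠ[𝓝 p] fun _ ↦ g p := by simpa [EventuallyEq] using h
    rw [hA, h'.deriv_eq] at hA0
    simp at hA0
  refine ⟨g p, (ball_subset_ball ?_).trans <|
    (hg.diffContOnCl.ball_subset_image_closedBall (by positivity) hsphere hfreq).trans
      (image_subset_range _ _)⟩
  linarith

/-- Every disc of radius `4` contains a point at which the cosine is an integer. -/
theorem Complex.exists_dist_lt_cos_eq_int (w : ℂ) :
    ∃ v : ℂ, dist v w < 4 ∧ ∃ n : ℤ, cos v = n := by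
  obtain ⟨s, hs, hsw⟩ : ∃ s : ℝ, (s = 1 ∨ s = -1) ∧ w.im = s * |w.im| := by
    rcases le_total 0 w.im with h | h
    · exact ⟨1, .inl rfl, by simp [abs_of_nonneg h]⟩
    · exact ⟨-1, .inr rfl, by simp [abs_of_nonpos h]⟩
  set y := |w.im|
  have hy : 0 ≤ y := abs_nonneg _
  set n := ⌊Real.cosh y⌋₊
  have hn : 1 ≤ n := (Nat.one_le_floor_iff _).mpr (Real.one_le_cosh y)
  have hn' : (1 : ℝ) ≤ n := by exact_mod_cast hn
  have hny : (n : ℝ) ≤ Real.cosh y := Nat.floor_le (Real.cosh_pos y).le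
  set x := Real.arcosh n
  have hx : 0 ≤ x := Real.arcosh_nonneg hn'
  have hcx : Real.cosh x = n := Real.cosh_arcosh hn'
  have hxy : x ≤ y := by
    rw [← hcx, Real.cosh_le_cosh, abs_of_nonneg hx, abs_of_nonneg hy] at hny
    exact hny
  have hyx : y < x + 2 := by
    have h1 : Real.cosh y < n + 1 := Nat.lt_floor_add_one _
    have h2 : 2 ≤ Real.cosh 2 := by
      rw [Real.cosh_eq]
      have h3 : Real.exp 2 = Real.exp 1 * Real.exp 1 := by rw [← Real.exp_add]; norm_num
      nlinarith [Real.exp_one_gt_d9, Real.exp_pos (-2)]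
    have h3 : (n : ℝ) + 1 ≤ Real.cosh (x + 2) := by
      rw [Real.cosh_add, hcx]
      have : 0 ≤ Real.sinh x * Real.sinh 2 :=
        mul_nonneg (Real.sinh_nonneg_iff.mpr hx) (Real.sinh_nonneg_iff.mpr (by norm_num))
      nlinarith
    have h4 := h1.trans_le h3
    rwa [Real.cosh_lt_cosh, abs_of_nonneg hy, abs_of_nonneg (by positivity)] at h4
  set m := round (w.re / Real.pi)
  have hm : |m * Real.pi - w.re| ≤ Real.pi / 2 := by
    have h1 := abs_sub_round (w.re / Real.pi)
    have h2 : m * Real.pi - w.re = -((w.re / Real.pi - m) * Real.pi) := by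
      field_simp
      ring
    rw [h2, abs_neg, abs_mul, abs_of_pos Real.pi_pos]
    nlinarith [Real.pi_pos]
  refine ⟨(m * Real.pi : ℝ) + (s * x : ℝ) * I, ?_, (-1) ^ m.natAbs * n, ?_⟩
  · have hs1 : |s| = 1 := by rcases hs with rfl | rfl <;> simp
    have him : |s * x - w.im| < 2 := by
      rw [hsw, ← mul_sub, abs_mul, hs1, one_mul, abs_lt]
      constructor <;> linarith
    rw [dist_eq_norm]
    refine (norm_le_abs_re_add_abs_im _).trans_lt ?_
    simp only [sub_re, add_re, ofReal_re, mul_re, I_re, mul_zero, ofReal_im, I_im, mul_one,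
      sub_self, add_zero, sub_im, add_im, mul_im, zero_add]
    linarith [Real.pi_lt_four]
  · have hcos : cos ((s * x : ℝ) * I) = n := by
      rw [cos_mul_I, ← ofReal_cosh]
      rcases hs with rfl | rfl <;> simp [hcx, Real.cosh_neg]
    have hsin : sin ((m * Real.pi : ℝ) : ℂ) = 0 := by
      rw [← ofReal_sin, Real.sin_int_mul_pi, ofReal_zero]
    have hpow : ((-1 : ℝ) ^ m) = (-1) ^ m.natAbs := by
      rcases Int.even_or_odd m with h | h
      · rw [h.neg_one_zpow, (Int.natAbs_even.mpr h).neg_one_pow]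
      · rw [h.neg_one_zpow, (Int.natAbs_odd.mpr h).neg_one_pow]
    rw [cos_add, hsin, hcos, ← ofReal_cos, Real.cos_int_mul_pi, hpow]
    push_cast
    ring

/-- An entire function omitting `1` and `-1` is constant. -/
theorem Complex.exists_eq_const_of_ne_one_of_ne_neg_one {f : ℂ → ℂ}
    (hf : Differentiable ℂ f) (h1 : ∀ z, f z ≠ 1) (h2 : ∀ z, f z ≠ -1) :
    ∃ c, ∀ z, f z = c := by
  obtain ⟨k, hk, hkf⟩ := exists_differentiable_cos_eq hf h1 h2
  have hpi : (Real.pi : ℂ) ≠ 0 := ofReal_ne_zero.mpr Real.pi_ne_zero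
  have hint : ∀ z, ∀ n : ℤ, k z / Real.pi ≠ n := fun z n h ↦ by
    rw [div_eq_iff hpi] at h
    have hcos : f z = ((-1 : ℝ) ^ n : ℝ) := by
      rw [← hkf, h, ← Real.cos_int_mul_pi]
      push_cast
      rfl
    rcases Int.even_or_odd n with hn | hn
    · exact h1 z (by rw [hcos, hn.neg_one_zpow, ofReal_one])
    · exact h2 z (by rw [hcos, hn.neg_one_zpow, ofReal_neg, ofReal_one])
  obtain ⟨g, hg, hgk⟩ := exists_differentiable_cos_eq (f := fun z ↦ k z / Real.pi) (by fun_prop)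
    (fun z ↦ by simpa using hint z 1) (fun z ↦ by simpa using hint z (-1))
  have hderiv : ∀ z, deriv g z = 0 := fun z ↦ by
    by_contra hz
    have hz' : 0 < ‖deriv g z‖ := norm_pos_iff.mpr hz
    obtain ⟨w, hw⟩ := exists_ball_subset_range_of_differentiable hg z (R := 192 / ‖deriv g z‖)
      (by positivity)
    obtain ⟨v, hv, n, hn⟩ := Complex.exists_dist_lt_cos_eq_int w
    have hrad : 192 / ‖deriv g z‖ * ‖deriv g z‖ / 48 = 4 := by
      field_simp
      norm_num
    rw [hrad] at hw
    obtain ⟨u, rfl⟩ := hw hv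
    exact hint u n ((hgk u).symm.trans hn)
  refine ⟨f 0, fun z ↦ ?_⟩
  have hk0 : k z / Real.pi = k 0 / Real.pi := by
    rw [← hgk, ← hgk, is_const_of_deriv_eq_zero hg hderiv z 0]
  rw [← hkf, ← hkf, (div_left_inj' hpi).mp hk0]

/-- **Picard's little theorem.**
If an entire function `f : ℂ → ℂ` omits two distinct values `a ≠ b`, then `f` is
constant. -/
theorem picard_little (f : ℂ → ℂ) (hf : Differentiable ℂ f) (a b : ℂ) (hab : a ≠ b)
    (ha : a ∉ Set.range f) (hb : b ∉ Set.range f) :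
    ∃ c : ℂ, ∀ z : ℂ, f z = c := by
  have hab' : b - a ≠ 0 := sub_ne_zero.mpr hab.symm
  obtain ⟨c, hc⟩ := exists_eq_const_of_ne_one_of_ne_neg_one
    (f := fun z ↦ 2 * (f z - a) / (b - a) - 1) (by fun_prop)
    (fun z h ↦ hb ⟨z, by field_simp at h; linear_combination h / 2⟩)
    (fun z h ↦ ha ⟨z, by field_simp at h; linear_combination h / 2⟩)
  refine ⟨(c + 1) * (b - a) / 2 + a, fun z ↦ ?_⟩
  rw [← hc z]
  field_simp
  ring
end
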